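/- Let A : [1,∞) → ℝ be nondecreasing and let B(x) = (1/x) ∫_1^x A(t) dt for x ≥ 1. Let c > 0 be a real constant. Suppose there is a constant K such that |B(x) − cx| ≤ K for all x ≥ 1. Then there exists a constant K' such that |A(x) − 2cx| ≤ K'·√x for all x ≥ 1. -/

import Mathlib

open MeasureTheory

/-- The integral of a function monotone on `[a, b]` lies between the values of the rectangles
given by the endpoints. -/
theorem MonotoneOn.mul_le_intervalIntegral_le_mul {f : ℝ → ℝ} {a b : ℝ} (hab : a ≤ b)
    (hf : MonotoneOn f (Set.Icc a b)) :
    (b - a) * f a ≤ ∫ t in a..b, f t ∧ ∫ t in a..b, f t ≤ (b - a) * f b := by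
  have hint : IntervalIntegrable f volume a b :=
    MonotoneOn.intervalIntegrable (by rwa [Set.uIcc_of_le hab])
  constructor
  · simpa using intervalIntegral.integral_mono_on hab
      (intervalIntegrable_const (c := f a)) hint
      fun t ht => hf (Set.left_mem_Icc.2 hab) ht ht.1
  · simpa using intervalIntegral.integral_mono_on hab hint
      (intervalIntegrable_const (c := f b))
      fun t ht => hf ht (Set.right_mem_Icc.2 hab) ht.2

/-- The instance `E(x) = x` of the Tauberian reduction lemma (Lemma 3.5 of the paper):
if `A` is nondecreasing on `[1,∞)`, `B(x) = (1/x) ∫_1^x A(t) dt`, `c > 0` and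
`|B(x) − cx| ≤ K` for all `x ≥ 1`, then `|A(x) − 2cx| ≤ K'·√x` for some constant `K'`
and all `x ≥ 1`. -/
theorem tauberian_reduction_bounded_error (A B : ℝ → ℝ) (c K : ℝ)
    (hA : MonotoneOn A (Set.Ici 1))
    (hB : ∀ x : ℝ, 1 ≤ x → B x = (1 / x) * ∫ t in (1:ℝ)..x, A t)
    (hc : 0 < c)
    (hBK : ∀ x : ℝ, 1 ≤ x → |B x - c * x| ≤ K) :
    ∃ K' : ℝ, ∀ x : ℝ, 1 ≤ x → |A x - 2 * c * x| ≤ K' * Real.sqrt x := by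
  have hAint {a b : ℝ} (ha : 1 ≤ a) (hb : 1 ≤ b) : IntervalIntegrable A volume a b :=
    (hA.mono fun t ht => (le_inf ha hb).trans ht.1).intervalIntegrable
  have hF {x : ℝ} (hx : 1 ≤ x) : |(∫ t in (1:ℝ)..x, A t) - c * x ^ 2| ≤ K * x := by
    have hx0 : 0 < x := by linarith
    have h : (∫ t in (1:ℝ)..x, A t) - c * x ^ 2 = (B x - c * x) * x := by
      rw [hB x hx]
      field_simp
    rw [h, abs_mul, abs_of_pos hx0]
    exact mul_le_mul_of_nonneg_right (hBK x hx) hx0.le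
  have hbounds {a b : ℝ} (ha : 1 ≤ a) (hab : a ≤ b) :
      (b - a) * A a ≤ c * (b ^ 2 - a ^ 2) + K * (a + b) ∧
        c * (b ^ 2 - a ^ 2) - K * (a + b) ≤ (b - a) * A b := by
    have hb := ha.trans hab
    have hadd := intervalIntegral.integral_add_adjacent_intervals (hAint le_rfl ha) (hAint ha hb)
    obtain ⟨hl, hu⟩ := MonotoneOn.mul_le_intervalIntegral_le_mul hab
      (hA.mono fun t ht => ha.trans ht.1)
    have h1 := abs_le.1 (hF ha)
    have h2 := abs_le.1 (hF hb)
    constructor <;> linarith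
  have hK : 0 ≤ K := (abs_nonneg _).trans (hBK 1 le_rfl)
  refine ⟨9 * c + 3 * K + |A 1|, fun x hx => ?_⟩
  obtain ⟨s, hs, hsx⟩ : ∃ s, s = √x ∧ x = s ^ 2 := ⟨_, rfl, (Real.sq_sqrt (by linarith)).symm⟩
  have hs1 : 1 ≤ s := hs ▸ Real.one_le_sqrt.2 hx
  have hs0 : 0 < s := by linarith
  rw [← hs]
  have hcs : 0 ≤ c * s := by positivity
  have hKs : 0 ≤ K * s := by positivity
  have hKK : K ≤ K * s := le_mul_of_one_le_right hK hs1
  have hAs : |A 1| ≤ |A 1| * s := le_mul_of_one_le_right (abs_nonneg _) hs1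
  have hA0 := abs_nonneg (A 1)
  rw [abs_le]
  constructor
  · rcases le_or_gt 2 s with h2 | h2
    · have h := (hbounds (a := x - s) (b := x) (by nlinarith) (by linarith)).2
      have h' : s * (2 * c * x - c * s - 2 * K * s + K) ≤ s * A x := by
        rw [hsx] at h ⊢
        linarith
      linarith [le_of_mul_le_mul_left h' hs0]
    · have hA1 := hA (Set.mem_Ici.2 le_rfl) (Set.mem_Ici.2 hx) hx
      have hx4 : c * x ≤ c * (4 * s) := mul_le_mul_of_nonneg_left (by nlinarith) hc.le
      linarith [neg_abs_le (A 1)]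
  · have h := (hbounds (a := x) (b := x + s) hx (by linarith)).1
    have h' : s * A x ≤ s * (2 * c * x + c * s + 2 * K * s + K) := by
      rw [hsx] at h ⊢
      linarith
    linarith [le_of_mul_le_mul_left h' hs0]
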